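/- For every real ε > 0 there exists a natural number n₀ such that for every connected finite simple graph G on n ≥ n₀ vertices and all vertices s, t of G, the graph G contains a spanning walk from s to t of length at most (19/12 + ε)·OPT_LP(G,s,t). -/

import Mathlib

open scoped Classical

/-- The total LP value of edges of `G` crossing the cut `(S, Sᶜ)`:
the sum of `x e` over edges `e` of `G` with exactly one endpoint in `S`. -/
noncomputable def cutValue {V : Type*} [Fintype V] (G : SimpleGraph V)
    (x : Sym2 V → ℝ) (S : Set V) : ℝ :=
  ∑ e ∈ Finset.univ.filter
      (fun e : Sym2 V => e ∈ G.edgeSet ∧ ∃ a b, e = s(a, b) ∧ a ∈ S ∧ b ∉ S), x e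

/-- The total value `∑_{e ∈ E} x_e` of a putative Held-Karp solution. -/
noncomputable def lpValue {V : Type*} [Fintype V] (G : SimpleGraph V)
    (x : Sym2 V → ℝ) : ℝ :=
  ∑ e ∈ Finset.univ.filter (fun e : Sym2 V => e ∈ G.edgeSet), x e

/-- `x` is a feasible solution of the Held-Karp path relaxation `LP(G,s,t)`. -/
def IsHeldKarpPath {V : Type*} [Fintype V] (G : SimpleGraph V) (s t : V)
    (x : Sym2 V → ℝ) : Prop :=
  (∀ e ∈ G.edgeSet, 0 ≤ x e) ∧
  (∀ S : Set V, S.Nonempty → S ≠ Set.univ → (s ∈ S ↔ t ∈ S) → 2 ≤ cutValue G x S) ∧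
  (∀ S : Set V, ¬(s ∈ S ↔ t ∈ S) → 1 ≤ cutValue G x S)

/-- The optimal value `OPT_LP(G,s,t)` of the Held-Karp path relaxation. -/
noncomputable def optLPPath {V : Type*} [Fintype V] (G : SimpleGraph V) (s t : V) : ℝ :=
  sInf {y | ∃ x, IsHeldKarpPath G s t x ∧ lpValue G x = y}

namespace EdgeSpace

open Finset

variable {V E : Type*}

/-- The indicator vector of a vertex over `ZMod 2`. -/
noncomputable def vertexVec (v : V) : V → ZMod 2 := fun w => if w = v then 1 else 0

/-- The mod 2 boundary of a set of edges, each edge `e` having the end points `a e` and `b e`. -/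
noncomputable def boundary (a b : E → V) (F : Finset E) : V → ZMod 2 :=
  ∑ e ∈ F, (vertexVec (a e) + vertexVec (b e))

/-- The edge `e` is incident with `u`. -/
def Touches (a b : E → V) (u : V) (e : E) : Prop := a e = u ∨ b e = u

/-- The end of the edge `e` opposite to `u`. -/
noncomputable def otherEnd (a b : E → V) (u : V) (e : E) : V := if a e = u then b e else a e

lemma add_self_zmod_two {α : Type*} (f : α → ZMod 2) : f + f = 0 := by
  funext v; exact CharTwo.add_self_eq_zero _

lemma zmod_two_cases (z : ZMod 2) : z = 0 ∨ z = 1 := by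
  revert z; decide

@[simp] lemma vertexVec_self (v : V) : vertexVec v v = 1 := by simp [vertexVec]

lemma vertexVec_of_ne {v w : V} (h : w ≠ v) : vertexVec v w = 0 := by simp [vertexVec, h]

lemma eq_of_vertexVec_add_apply_eq_zero {v w : V} (h : (vertexVec v + vertexVec w) v = 0) :
    w = v := by
  by_contra hne
  simp [vertexVec_of_ne (Ne.symm hne)] at h

section Boundary

variable (a b : E → V)

@[simp] lemma boundary_empty : boundary a b ∅ = 0 := by simp [boundary]

@[simp] lemma boundary_singleton (e : E) :
    boundary a b {e} = vertexVec (a e) + vertexVec (b e) := by simp [boundary]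

lemma boundary_union_of_disjoint {F K : Finset E} (h : Disjoint F K) :
    boundary a b (F ∪ K) = boundary a b F + boundary a b K := by
  simp only [boundary]
  exact sum_union h

lemma boundary_sdiff {F K : Finset E} (h : K ⊆ F) :
    boundary a b (F \ K) = boundary a b F + boundary a b K := by
  have h1 := boundary_union_of_disjoint a b (sdiff_disjoint : Disjoint (F \ K) K)
  rw [sdiff_union_of_subset h] at h1
  rw [h1, add_assoc, add_self_zmod_two, add_zero]

lemma boundary_symmDiff (F K : Finset E) :
    boundary a b (symmDiff F K) = boundary a b F + boundary a b K := by
  have h : symmDiff F K = (F \ (F ∩ K)) ∪ (K \ (F ∩ K)) := by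
    ext e; simp only [mem_symmDiff, mem_union, mem_sdiff, mem_inter]; tauto
  have hd : Disjoint (F \ (F ∩ K)) (K \ (F ∩ K)) := by
    rw [disjoint_left]; intro e; simp only [mem_sdiff, mem_inter]; tauto
  rw [h, boundary_union_of_disjoint a b hd, boundary_sdiff a b inter_subset_left,
    boundary_sdiff a b inter_subset_right]
  have := add_self_zmod_two (boundary a b (F ∩ K))
  linear_combination this

lemma exists_subset_boundary_eq_add {D F K : Finset E} (hF : F ⊆ D) (hK : K ⊆ D) :
    ∃ P ⊆ D, boundary a b P = boundary a b F + boundary a b K :=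
  ⟨symmDiff F K, fun _ he => (mem_symmDiff.1 he).elim (fun h => hF h.1) fun h => hK h.1,
    boundary_symmDiff a b F K⟩

lemma boundary_erase {F : Finset E} {e : E} (h : e ∈ F) :
    boundary a b (F.erase e) = boundary a b F + (vertexVec (a e) + vertexVec (b e)) := by
  rw [← sdiff_singleton_eq_erase, boundary_sdiff a b (singleton_subset_iff.2 h),
    boundary_singleton]

lemma ends_eq {u : V} {e : E} (h : Touches a b u e) :
    vertexVec (a e) + vertexVec (b e) = vertexVec u + vertexVec (otherEnd a b u e) := by
  unfold otherEnd
  split_ifs with h1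
  · rw [h1]
  · rcases h with h | h
    · exact absurd h h1
    · rw [h, add_comm]

lemma boundary_apply_eq_zero {F : Finset E} {u : V} (h : ∀ e ∈ F, ¬ Touches a b u e) :
    boundary a b F u = 0 := by
  rw [boundary, Finset.sum_apply]
  refine sum_eq_zero fun e he => ?_
  have := h e he
  simp only [Touches, not_or] at this
  simp [vertexVec_of_ne (Ne.symm this.1), vertexVec_of_ne (Ne.symm this.2)]

lemma boundary_filter {χ : V → ZMod 2} {F : Finset E} (h : ∀ e ∈ F, χ (a e) = χ (b e)) :
    boundary a b (F.filter fun e => χ (a e) = 1) = χ * boundary a b F := by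
  rw [boundary, boundary, sum_filter, mul_sum]
  refine sum_congr rfl fun e he => ?_
  have hmul : ∀ v : V, χ * vertexVec v = if χ v = 1 then vertexVec v else 0 := by
    intro v
    funext w
    by_cases hw : w = v
    · subst hw
      rcases zmod_two_cases (χ w) with h0 | h0 <;> simp [h0]
    · split_ifs <;> simp [vertexVec_of_ne hw]
  rw [mul_add, hmul, hmul, ← h e he]
  split_ifs <;> simp

variable [Fintype V]

lemma dotProduct_vertexVec (χ : V → ZMod 2) (v : V) : χ ⬝ᵥ vertexVec v = χ v := by
  simp [dotProduct, vertexVec]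

lemma dotProduct_boundary (χ : V → ZMod 2) (F : Finset E) :
    χ ⬝ᵥ boundary a b F = ∑ e ∈ F, (χ (a e) + χ (b e)) := by
  rw [boundary, dotProduct_sum]
  simp [dotProduct_add, dotProduct_vertexVec]

lemma dotProduct_boundary_eq_card (χ : V → ZMod 2) (F : Finset E) :
    χ ⬝ᵥ boundary a b F = ((F.filter fun e => χ (a e) ≠ χ (b e)).card : ZMod 2) := by
  rw [dotProduct_boundary, card_filter, Nat.cast_sum]
  refine sum_congr rfl fun e _ => ?_
  have : ∀ y z : ZMod 2, y + z = ((if y ≠ z then 1 else 0 : ℕ) : ZMod 2) := by decide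
  convert this _ _

end Boundary

/-- The edges of `D` join vertices `v` and `w`: some subset of `D` has boundary `v + w`. -/
def Joins (a b : E → V) (D : Finset E) (v w : V) : Prop :=
  ∃ P ⊆ D, boundary a b P = vertexVec v + vertexVec w

section Joins

variable {a b : E → V} {D : Finset E}

lemma Joins.refl (v : V) : Joins a b D v v :=
  ⟨∅, empty_subset _, by rw [boundary_empty, add_self_zmod_two]⟩

lemma Joins.trans {u v w : V} (h : Joins a b D u v) (h' : Joins a b D v w) :
    Joins a b D u w := by
  obtain ⟨P, hP, hbP⟩ := h
  obtain ⟨Q, hQ, hbQ⟩ := h'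
  obtain ⟨R, hR, hbR⟩ := exists_subset_boundary_eq_add a b hP hQ
  refine ⟨R, hR, ?_⟩
  rw [hbR, hbP, hbQ]
  have := add_self_zmod_two (vertexVec v)
  linear_combination this

lemma Joins.symm {u v : V} (h : Joins a b D u v) : Joins a b D v u := by
  obtain ⟨P, hP, hbP⟩ := h
  exact ⟨P, hP, by rw [hbP, add_comm]⟩

lemma Joins.of_mem {e : E} (he : e ∈ D) : Joins a b D (a e) (b e) :=
  ⟨{e}, singleton_subset_iff.2 he, boundary_singleton a b e⟩

/-- The indicator of the set of vertices joined to `v` by `D`. -/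
noncomputable def component (a b : E → V) (D : Finset E) (v : V) : V → ZMod 2 :=
  fun w => if Joins a b D v w then 1 else 0

lemma component_eq_one_iff {v w : V} : component a b D v w = 1 ↔ Joins a b D v w := by
  unfold component; split_ifs with h <;> simp [h]

lemma component_eq_zero_iff {v w : V} : component a b D v w = 0 ↔ ¬ Joins a b D v w := by
  unfold component; split_ifs with h <;> simp [h]

lemma component_ends_eq (v : V) {e : E} (he : e ∈ D) :
    component a b D v (a e) = component a b D v (b e) := by
  have : Joins a b D v (a e) ↔ Joins a b D v (b e) :=
    ⟨fun h => h.trans (.of_mem he), fun h => h.trans (Joins.of_mem he).symm⟩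
  simp [component, this]

/-- At a vertex `u` of degree at least two in an edge set with boundary `x + u`, two edges
lie on a common circuit. -/
lemma exists_joins_otherEnd [Fintype V] {x u : V}
    (hD : boundary a b D = vertexVec x + vertexVec u)
    (hloop : ∀ e ∈ D, a e ≠ b e)
    (hcard : 2 ≤ (D.filter (Touches a b u)).card) :
    ∃ e₁ ∈ D.filter (Touches a b u), ∃ e₂ ∈ D.filter (Touches a b u), e₁ ≠ e₂ ∧
      Joins a b (D.filter fun e => ¬ Touches a b u e) (otherEnd a b u e₁) (otherEnd a b u e₂) := by
  by_contra! hcon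
  set D₁ := D.filter fun e => ¬ Touches a b u e with hD₁
  have hx : ∀ e ∈ D.filter (Touches a b u), Joins a b D₁ (otherEnd a b u e) x := by
    intro e he
    have heD := mem_filter.1 he
    set χ := component a b D₁ (otherEnd a b u e) with hχ
    have hne : otherEnd a b u e ≠ u := by
      have := hloop e heD.1
      unfold otherEnd
      split_ifs with h
      · rw [h] at this; exact this.symm
      · exact h
    have hu : χ u = 0 := by
      rw [hχ, component_eq_zero_iff]
      rintro ⟨P, hP, hbP⟩
      have h0 := boundary_apply_eq_zero a b (F := P) (u := u)
        (fun f hf => (mem_filter.1 (hP hf)).2)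
      rw [hbP, add_comm] at h0
      exact hne (eq_of_vertexVec_add_apply_eq_zero h0)
    have h1 := dotProduct_boundary a b χ D
    rw [hD, dotProduct_add, dotProduct_vertexVec, dotProduct_vertexVec, hu, add_zero,
      sum_eq_single_of_mem e heD.1] at h1
    · have hends := congrArg (fun f => χ ⬝ᵥ f) (ends_eq a b heD.2)
      simp only [dotProduct_add, dotProduct_vertexVec] at hends
      rw [hends, hu, zero_add, hχ, component_eq_one_iff.2 (Joins.refl _)] at h1
      exact component_eq_one_iff.1 h1
    · intro f hf hfe
      by_cases hft : Touches a b u f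
      · have hends := congrArg (fun f => χ ⬝ᵥ f) (ends_eq a b hft)
        simp only [dotProduct_add, dotProduct_vertexVec] at hends
        rw [hends, hu, zero_add, hχ, component_eq_zero_iff]
        exact hcon e he f (mem_filter.2 ⟨hf, hft⟩) (Ne.symm hfe)
      · rw [hχ, component_ends_eq _ (mem_filter.2 ⟨hf, hft⟩), CharTwo.add_self_eq_zero]
  obtain ⟨e₁, h₁, e₂, h₂, hne⟩ := one_lt_card.1 hcard
  exact hcon e₁ h₁ e₂ h₂ hne ((hx e₁ h₁).trans (hx e₂ h₂).symm)

end Joins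

section TJoin

/-- A subset of the star of `u` has boundary `Z`, provided that `Z` is killed by the contraction
of the closed neighbourhood of `u`. -/
lemma exists_star_boundary [Fintype V] {a b : E → V} {D : Finset E} {u : V} {r : V → V}
    (hr : ∀ w, r w = w ∨ r w = u ∧ ∃ e ∈ D, Touches a b u e ∧ otherEnd a b u e = w)
    {Z : V → ZMod 2} (hZ : ∑ w, Z w • vertexVec (r w) = 0) :
    ∃ S ⊆ D.filter (Touches a b u), boundary a b S = Z := by
  have hZ' : Z = ∑ w, Z w • (vertexVec w + vertexVec (r w)) := by
    simp only [smul_add]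
    rw [sum_add_distrib, hZ, add_zero]
    funext v
    simp [Finset.sum_apply, vertexVec]
  rw [hZ']
  refine sum_induction _ (fun f => ∃ S ⊆ D.filter (Touches a b u), boundary a b S = f) ?_ ?_ ?_
  · rintro f g ⟨S, hS, rfl⟩ ⟨S', hS', rfl⟩
    exact exists_subset_boundary_eq_add a b hS hS'
  · exact ⟨∅, empty_subset _, boundary_empty a b⟩
  · intro w _
    rcases zmod_two_cases (Z w) with h0 | h0
    · exact ⟨∅, empty_subset _, by simp [h0]⟩
    · rcases hr w with h | ⟨h, e, he, het, hew⟩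
      · exact ⟨∅, empty_subset _, by rw [h, add_self_zmod_two]; simp⟩
      · refine ⟨{e}, singleton_subset_iff.2 (mem_filter.2 ⟨he, het⟩), ?_⟩
        rw [boundary_singleton, ends_eq a b het, hew, h, h0, one_smul, add_comm]

/-- In a bipartite graph, a nonzero vector `T` which is a boundary has a vertex `u` with `T u = 1`
such that every edge set with boundary `T` has at least `τ - 1` edges outside the star of `u`,
where `τ` is the minimum size of an edge set with boundary `T`. -/
lemma exists_vertex_card_filter_not_touches [Fintype V] {a b : E → V} {c : V → ZMod 2}
    {D : Finset E} (hc : ∀ e ∈ D, c (a e) ≠ c (b e)) {T : V → ZMod 2} (hT : T ≠ 0)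
    {F₀ : Finset E} (hF₀ : F₀ ⊆ D) (hbF₀ : boundary a b F₀ = T)
    (hmin : ∀ F ⊆ D, boundary a b F = T → F₀.card ≤ F.card) :
    ∃ u, T u = 1 ∧ ∀ F ⊆ D, boundary a b F = T →
      F₀.card ≤ (F.filter fun e => ¬ Touches a b u e).card + 1 := by
  have hloop : ∀ e ∈ D, a e ≠ b e := fun e he h => hc e he (by rw [h])
  obtain ⟨e₀, he₀⟩ : F₀.Nonempty := by
    rw [nonempty_iff_ne_empty]
    rintro rfl
    exact hT (by rw [← hbF₀, boundary_empty])
  set x := a e₀ with hx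
  obtain ⟨M, hM, hMmin⟩ := exists_min_image
    (D.powerset.filter fun M => ∃ u, boundary a b M = T + (vertexVec x + vertexVec u)) card
    ⟨F₀, mem_filter.2 ⟨mem_powerset.2 hF₀, x, by rw [hbF₀, add_self_zmod_two, add_zero]⟩⟩
  obtain ⟨hMD, u, hbM⟩ := mem_filter.1 hM
  rw [mem_powerset] at hMD
  have hMmin' : ∀ M' ⊆ D, ∀ v, boundary a b M' = T + (vertexVec x + vertexVec v) →
      M.card ≤ M'.card := fun M' h v h' => hMmin M' (mem_filter.2 ⟨mem_powerset.2 h, v, h'⟩)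
  have hMF : M.card < F₀.card := by
    refine lt_of_le_of_lt (hMmin' (F₀.erase e₀) ((erase_subset _ _).trans hF₀) (b e₀) ?_)
      (card_erase_lt_of_mem he₀)
    rw [boundary_erase a b he₀, hbF₀]
  have hux : u ≠ x := by
    rintro rfl
    rw [add_self_zmod_two, add_zero] at hbM
    exact absurd (hmin M hMD hbM) (not_le.2 hMF)
  have hA : ∀ M' ⊆ D, boundary a b M' = T + (vertexVec x + vertexVec u) → M'.card ≤ M.card →
      ∀ e ∈ M', ¬ Touches a b u e := by
    intro M' hM' hb hle e he het
    have h1 := hMmin' (M'.erase e) ((erase_subset _ _).trans hM') (otherEnd a b u e) (by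
      rw [boundary_erase a b he, hb, ends_eq a b het]
      have := add_self_zmod_two (vertexVec u)
      linear_combination this)
    exact absurd (h1.trans_lt (card_erase_lt_of_mem he)) (not_lt.2 hle)
  have hMu := hA M hMD hbM le_rfl
  refine ⟨u, ?_, ?_⟩
  · have h0 := boundary_apply_eq_zero a b hMu
    rw [hbM, Pi.add_apply, Pi.add_apply, vertexVec_self, vertexVec_of_ne hux, zero_add] at h0
    rcases zmod_two_cases (T u) with h | h
    · rw [h] at h0; simp at h0
    · exact h
  suffices H : ∀ n, ∀ F ⊆ D, F.card = n → boundary a b F = T →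
      F₀.card ≤ (F.filter fun e => ¬ Touches a b u e).card + 1 from
    fun F hF => H _ F hF rfl
  intro n
  induction n using Nat.strong_induction_on with
  | _ n ih =>
  intro F hF hn hbF
  have hsplit := card_filter_add_card_filter_not (s := F) (Touches a b u)
  by_cases hdeg : (F.filter (Touches a b u)).card ≤ 1
  · have := hmin F hF hbF
    omega
  have hND : symmDiff F M ⊆ D := by
    intro e he
    rcases mem_symmDiff.1 he with h | h
    exacts [hF h.1, hMD h.1]
  have hstar : (symmDiff F M).filter (Touches a b u) = F.filter (Touches a b u) := by
    ext e
    have := hMu e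
    simp only [mem_filter, mem_symmDiff]
    tauto
  obtain ⟨e₁, he₁, e₂, he₂, hne, P, hP, hbP⟩ := exists_joins_otherEnd (a := a) (b := b)
    (D := symmDiff F M) (x := x) (u := u)
    (by rw [boundary_symmDiff, hbF, hbM, ← add_assoc, add_self_zmod_two, zero_add])
    (fun e he => hloop e (hND he)) (by rw [hstar]; omega)
  rw [hstar, mem_filter] at he₁ he₂
  have hP' : ∀ e ∈ P, (e ∈ F ∧ e ∉ M ∨ e ∈ M ∧ e ∉ F) ∧ ¬ Touches a b u e := by
    intro e he
    have := hP he
    rwa [mem_filter, mem_symmDiff] at this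
  have hPD : P ⊆ D := fun e he => hND (mem_filter.1 (hP he)).1
  have hpair : boundary a b {e₁, e₂} = boundary a b P := by
    rw [insert_eq, boundary_union_of_disjoint a b (by simpa using hne), boundary_singleton,
      boundary_singleton, ends_eq a b he₁.2, ends_eq a b he₂.2, hbP]
    have := add_self_zmod_two (vertexVec u)
    linear_combination this
  have hcardpair : ({e₁, e₂} : Finset E).card = 2 := card_pair hne
  have he₁M : e₁ ∉ M := fun h => hMu _ h he₁.2
  have he₂M : e₂ ∉ M := fun h => hMu _ h he₂.2
  have he₁P : e₁ ∉ P := fun h => (hP' _ h).2 he₁.2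
  have he₂P : e₂ ∉ P := fun h => (hP' _ h).2 he₂.2
  -- exchanging along the circuit makes `M` touch `u`, so it gains at least two edges
  have hdisj : Disjoint (symmDiff M P) {e₁, e₂} := by
    rw [disjoint_right]
    intro e he
    rw [mem_symmDiff]
    rcases mem_insert.1 he with rfl | he
    · tauto
    · rw [mem_singleton.1 he]; tauto
  have hbM' : boundary a b (symmDiff M P ∪ {e₁, e₂}) = T + (vertexVec x + vertexVec u) := by
    rw [boundary_union_of_disjoint a b hdisj, boundary_symmDiff, hpair, hbM, add_assoc,
      add_self_zmod_two, add_zero]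
  have hM'D : symmDiff M P ∪ {e₁, e₂} ⊆ D := by
    intro e he
    simp only [mem_union, mem_symmDiff, mem_insert, mem_singleton] at he
    rcases he with (h | h) | rfl | rfl
    exacts [hMD h.1, hPD h.1, hF he₁.1, hF he₂.1]
  have hM'card := card_union_of_disjoint hdisj
  have hgt : M.card < (symmDiff M P ∪ {e₁, e₂}).card := by
    by_contra hle
    exact hA _ hM'D hbM' (not_lt.1 hle) e₁ (by simp) he₁.2
  have hparity : ∀ K ⊆ D, (K.card : ZMod 2) = c ⬝ᵥ boundary a b K := by
    intro K hK
    rw [dotProduct_boundary_eq_card, filter_true_of_mem fun e he => hc e (hK he)]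
  have hmod : M.card % 2 = (symmDiff M P ∪ {e₁, e₂}).card % 2 := by
    have h := (hparity M hMD).trans ((congrArg (c ⬝ᵥ ·) (hbM.trans hbM'.symm)).trans
      (hparity _ hM'D).symm)
    exact (ZMod.natCast_eq_natCast_iff' _ _ _).1 h
  have hsd : ∀ K : Finset E, (symmDiff K P).card + 2 * (K ∩ P).card = K.card + P.card := by
    intro K
    have h1 := card_sdiff_add_card_inter K P
    have h2 := card_sdiff_add_card_inter P K
    rw [inter_comm P K] at h2
    have h3 : (symmDiff K P).card = (K \ P).card + (P \ K).card :=
      card_union_of_disjoint disjoint_sdiff_sdiff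
    omega
  have hPsplit : P.card = (F ∩ P).card + (M ∩ P).card := by
    rw [← card_union_of_disjoint]
    · congr 1
      ext e
      have := hP' e
      simp only [mem_union, mem_inter]
      tauto
    · rw [disjoint_left]
      intro e
      have := hP' e
      simp only [mem_inter]
      tauto
  have hsub : {e₁, e₂} ⊆ symmDiff F P := by
    intro e he
    rw [mem_symmDiff]
    rcases mem_insert.1 he with rfl | he
    · exact .inl ⟨he₁.1, he₁P⟩
    · rw [mem_singleton.1 he]; exact .inl ⟨he₂.1, he₂P⟩
  have hF'card := card_sdiff_add_card_eq_card hsub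
  have hF'D : symmDiff F P \ {e₁, e₂} ⊆ D := by
    intro e he
    rcases mem_symmDiff.1 (mem_sdiff.1 he).1 with h | h
    exacts [hF h.1, hPD h.1]
  have hF'split := card_filter_add_card_filter_not (s := symmDiff F P \ {e₁, e₂}) (Touches a b u)
  have hstar' : (symmDiff F P \ {e₁, e₂}).filter (Touches a b u)
      = F.filter (Touches a b u) \ {e₁, e₂} := by
    ext e
    have := hP' e
    simp only [mem_filter, mem_symmDiff, mem_sdiff]
    tauto
  have hstar'card := card_sdiff_add_card_eq_card
    (show {e₁, e₂} ⊆ F.filter (Touches a b u) by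
      intro e he
      rcases mem_insert.1 he with rfl | he
      · exact mem_filter.2 he₁
      · rw [mem_singleton.1 he]; exact mem_filter.2 he₂)
  rw [← hstar'] at hstar'card
  have hsM := hsd M
  have hsF := hsd F
  have hrec := ih (symmDiff F P \ {e₁, e₂}).card (by omega) _ hF'D rfl (by
    rw [boundary_sdiff a b hsub, boundary_symmDiff, hpair, hbF, add_assoc, add_self_zmod_two,
      add_zero])
  omega

/-- Bipartite case of the Edmonds–Johnson theorem for unit weights. -/
theorem exists_boundary_eq_card_le_of_bipartite [Fintype V] (x : E → ℝ) (n : ℕ) :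
    ∀ (a b : E → V) (c : V → ZMod 2) (D : Finset E) (T : V → ZMod 2), D.card = n →
      (∀ e ∈ D, c (a e) ≠ c (b e)) → (∀ e ∈ D, 0 ≤ x e) →
      (∀ χ : V → ZMod 2, χ ⬝ᵥ T = 1 → 1 ≤ ∑ e ∈ D, if χ (a e) ≠ χ (b e) then x e else 0) →
      (∃ F ⊆ D, boundary a b F = T) →
      ∃ F ⊆ D, boundary a b F = T ∧ (F.card : ℝ) ≤ ∑ e ∈ D, x e := by
  induction n using Nat.strong_induction_on with
  | _ n ih =>
  intro a b c D T hn hc hx hcut hex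
  by_cases hT : T = 0
  · exact ⟨∅, empty_subset _, by rw [boundary_empty, hT], by
      rw [card_empty, Nat.cast_zero]; exact sum_nonneg hx⟩
  obtain ⟨F₀, hF₀, hmin⟩ := exists_min_image (D.powerset.filter fun F => boundary a b F = T) card
    (by
      obtain ⟨F, hF, hb⟩ := hex
      exact ⟨F, mem_filter.2 ⟨mem_powerset.2 hF, hb⟩⟩)
  rw [mem_filter, mem_powerset] at hF₀
  obtain ⟨hF₀D, hbF₀⟩ := hF₀
  obtain ⟨u, hTu, hu⟩ := exists_vertex_card_filter_not_touches hc hT hF₀D hbF₀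
    fun F hF hb => hmin F (mem_filter.2 ⟨mem_powerset.2 hF, hb⟩)
  refine ⟨F₀, hF₀D, hbF₀, ?_⟩
  set D' := D.filter fun e => ¬ Touches a b u e with hD'
  have hsum := sum_filter_add_sum_filter_not D (Touches a b u) x
  have hone : 1 ≤ ∑ e ∈ D.filter (Touches a b u), x e := by
    refine (hcut (vertexVec u) (by rw [dotProduct_comm, dotProduct_vertexVec, hTu])).trans ?_
    rw [← sum_filter]
    refine sum_le_sum_of_subset_of_nonneg (fun e he => ?_) fun e he _ => hx e (mem_filter.1 he).1
    rw [mem_filter] at he ⊢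
    refine ⟨he.1, ?_⟩
    by_contra hnt
    rw [Touches, not_or] at hnt
    exact he.2 (by rw [vertexVec_of_ne hnt.1, vertexVec_of_ne hnt.2])
  set r : V → V := fun w =>
    if ∃ e ∈ D, Touches a b u e ∧ otherEnd a b u e = w then u else w with hr
  have hr' : ∀ w, r w = w ∨ r w = u ∧ ∃ e ∈ D, Touches a b u e ∧ otherEnd a b u e = w := by
    intro w
    simp only [hr]
    split_ifs with h
    · exact .inr ⟨rfl, h⟩
    · exact .inl rfl
  have hru : r u = u := by
    rcases hr' u with h | h
    exacts [h, h.1]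
  have hcolour : ∀ e ∈ D, Touches a b u e → c (otherEnd a b u e) = c u + 1 := by
    intro e he het
    have h1 := hc e he
    have h2 := congrArg (c ⬝ᵥ ·) (ends_eq a b het)
    simp only [dotProduct_add, dotProduct_vertexVec] at h2
    revert h1 h2
    generalize c (a e) = p
    generalize c (b e) = q
    generalize c u = y
    generalize c (otherEnd a b u e) = z
    revert p q y z
    decide
  set c' : V → ZMod 2 := fun w => if w = u then c u + 1 else c w with hc'
  have hc'r : ∀ w, w ≠ u → c' (r w) = c w := by
    intro w hw
    rcases hr' w with h | ⟨h, e, he, het, hew⟩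
    · simp [hc', h, hw]
    · rw [h, ← hew, hcolour e he het]; simp [hc']
  have hlin : ∀ F : Finset E, boundary (r ∘ a) (r ∘ b) F
      = ∑ w, boundary a b F w • vertexVec (r w) := by
    intro F
    have : ∀ v, vertexVec (r v) = ∑ w, vertexVec v w • vertexVec (r w) := by
      intro v
      simp [vertexVec]
    simp only [boundary, Finset.sum_apply, sum_smul, Pi.add_apply, add_smul]
    rw [sum_comm]
    refine sum_congr rfl fun e _ => ?_
    rw [sum_add_distrib, ← this, ← this]
    rfl
  set T' : V → ZMod 2 := ∑ w, T w • vertexVec (r w) with hT'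
  have hD'lt : D'.card < n := by
    rw [← hn]
    refine card_lt_card (filter_ssubset.2 ?_)
    by_contra! hcon
    have := boundary_apply_eq_zero a b (F := F₀) (u := u) fun e he => hcon e (hF₀D he)
    rw [hbF₀, hTu] at this
    exact one_ne_zero this
  have hnt : ∀ e ∈ D', e ∈ D ∧ a e ≠ u ∧ b e ≠ u := by
    intro e he
    have := mem_filter.1 he
    rwa [Touches, not_or] at this
  obtain ⟨F, hF, hbF, hcard⟩ := ih D'.card hD'lt (r ∘ a) (r ∘ b) c' D' T' rfl
    (fun e he => by
      have := hnt e he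
      simp only [Function.comp, hc'r _ this.2.1, hc'r _ this.2.2]
      exact hc e this.1)
    (fun e he => hx e (hnt e he).1)
    (fun χ hχ => by
      have h1 : (χ ∘ r) ⬝ᵥ T = 1 := by
        rw [← hχ, hT', dotProduct_sum]
        simp only [dotProduct_smul, dotProduct_vertexVec]
        exact sum_congr rfl fun w _ => mul_comm _ _
      refine (hcut _ h1).trans (le_of_eq ?_)
      rw [hD', sum_filter]
      refine sum_congr rfl fun e he => ?_
      by_cases het : Touches a b u e
      · have h2 : r (otherEnd a b u e) = u := by
          simp only [hr]
          rw [if_pos ⟨e, he, het, rfl⟩]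
        have h3 : r (a e) = u ∧ r (b e) = u := by
          rcases het with h | h
          · simp only [otherEnd, if_pos h] at h2
            exact ⟨by rw [h, hru], h2⟩
          · refine ⟨?_, by rw [h, hru]⟩
            by_cases h' : a e = u
            · rw [h', hru]
            · simpa only [otherEnd, if_neg h'] using h2
        simp [het, h3.1, h3.2]
      · simp [het])
    (by
      refine ⟨F₀.filter fun e => ¬ Touches a b u e, ?_, ?_⟩
      · exact filter_subset_filter _ hF₀D
      · have h1 : boundary (r ∘ a) (r ∘ b) F₀ = T' := by rw [hlin, hbF₀]
        have h2 : boundary (r ∘ a) (r ∘ b) (F₀.filter (Touches a b u)) = 0 := by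
          refine sum_eq_zero fun e he => ?_
          rw [mem_filter] at he
          have h3 : r (otherEnd a b u e) = u := by
            simp only [hr]
            rw [if_pos ⟨e, hF₀D he.1, he.2, rfl⟩]
          have h4 : r (a e) = r (b e) := by
            rcases he.2 with h | h
            · simp only [otherEnd, if_pos h] at h3
              rw [h, hru, h3]
            · by_cases h' : a e = u
              · rw [h', h]
              · simp only [otherEnd, if_neg h'] at h3
                rw [h, hru, h3]
          simp only [Function.comp, h4, add_self_zmod_two]
        rw [filter_not, boundary_sdiff _ _ (filter_subset _ _), h1, h2, add_zero])
  obtain ⟨S, hS, hbS⟩ := exists_star_boundary (a := a) (b := b) (D := D) (u := u) hr'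
    (Z := boundary a b F + T) (by
      simp only [Pi.add_apply, add_smul]
      rw [sum_add_distrib, ← hlin, hbF, ← hT', add_self_zmod_two])
  have hdisj : Disjoint F S := by
    rw [disjoint_left]
    intro e he he'
    exact (mem_filter.1 (hF he)).2 (mem_filter.1 (hS he')).2
  have hle := hu (F ∪ S)
    (union_subset (hF.trans (filter_subset _ _)) (hS.trans (filter_subset _ _)))
    (by rw [boundary_union_of_disjoint a b hdisj, hbS, ← add_assoc, add_self_zmod_two, zero_add])
  have hFS : (F ∪ S).filter (fun e => ¬ Touches a b u e) = F := by
    ext e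
    have h1 : e ∈ F → ¬ Touches a b u e := fun h => (mem_filter.1 (hF h)).2
    have h2 : e ∈ S → Touches a b u e := fun h => (mem_filter.1 (hS h)).2
    simp only [mem_filter, mem_union]
    tauto
  rw [hFS] at hle
  have hle' : (F₀.card : ℝ) ≤ F.card + 1 := by exact_mod_cast hle
  linarith

lemma boundary_subdivision_inl (a b : E → V) (F : Finset E) (v : V) :
    boundary (V := V ⊕ E) (fun f : E × Bool => Sum.inl (if f.2 then a f.1 else b f.1))
      (fun f => Sum.inr f.1) (F ×ˢ univ) (Sum.inl v) = boundary a b F v := by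
  simp only [boundary, Finset.sum_apply, sum_product, Fintype.sum_bool, Pi.add_apply, vertexVec]
  refine sum_congr rfl fun e _ => ?_
  simp

lemma boundary_subdivision_inr (a b : E → V) (F : Finset (E × Bool)) (e : E) :
    boundary (V := V ⊕ E) (fun f : E × Bool => Sum.inl (if f.2 then a f.1 else b f.1))
      (fun f => Sum.inr f.1) F (Sum.inr e)
      = (if (e, true) ∈ F then 1 else 0) + (if (e, false) ∈ F then 1 else 0) := by
  have h : ∀ i, (if (e, i) ∈ F then (1 : ZMod 2) else 0)
      = ∑ f ∈ F, if f = (e, i) then 1 else 0 := by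
    intro i
    rw [sum_ite_eq']
  rw [h, h, ← sum_add_distrib, boundary, Finset.sum_apply]
  refine sum_congr rfl fun f _ => ?_
  obtain ⟨e', i⟩ := f
  by_cases he : e' = e
  · subst he; cases i <;> simp [vertexVec]
  · simp [vertexVec, he, Ne.symm he]

/-- The Edmonds–Johnson theorem for unit weights: a nonnegative vector `x` with value at least one
on every `T`-odd cut of `D` dominates the size of some subset of `D` with boundary `T`. -/
theorem exists_boundary_eq_card_le [Fintype V] [Fintype E] (a b : E → V) (D : Finset E)
    (T : V → ZMod 2) (x : E → ℝ) (hx : ∀ e ∈ D, 0 ≤ x e)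
    (hcut : ∀ χ : V → ZMod 2, χ ⬝ᵥ T = 1 →
      1 ≤ ∑ e ∈ D, if χ (a e) ≠ χ (b e) then x e else 0)
    (hex : ∃ F ⊆ D, boundary a b F = T) :
    ∃ F ⊆ D, boundary a b F = T ∧ (F.card : ℝ) ≤ ∑ e ∈ D, x e := by
  set a' : E × Bool → V ⊕ E := fun f => Sum.inl (if f.2 then a f.1 else b f.1) with ha'
  set b' : E × Bool → V ⊕ E := fun f => Sum.inr f.1 with hb'
  obtain ⟨F, hF, hbF, hcard⟩ := exists_boundary_eq_card_le_of_bipartite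
    (fun f : E × Bool => x f.1) _ a' b' (Sum.elim 0 1) (D ×ˢ univ) (Sum.elim T 0) rfl
    (fun f _ => by simp [a', b'])
    (fun f hf => hx _ (mem_product.1 hf).1)
    (fun χ hχ => by
      have h1 : (χ ∘ Sum.inl) ⬝ᵥ T = 1 := by
        rw [← hχ]
        simp [dotProduct, Fintype.sum_sum_type]
      refine (hcut _ h1).trans ?_
      rw [sum_product]
      refine sum_le_sum fun e he => ?_
      have := hx e he
      simp only [Fintype.sum_bool, Function.comp, a', b', if_true, Bool.false_eq_true, if_false]
      split_ifs with h1 h2 h3 h4 <;> try linarith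
      push Not at h2 h4
      exact absurd (h2.trans h4.symm) h1)
    (by
      obtain ⟨F, hF, hbF⟩ := hex
      refine ⟨F ×ˢ univ, product_subset_product_left hF, ?_⟩
      funext v
      rcases v with v | e
      · rw [boundary_subdivision_inl, hbF]; rfl
      · rw [boundary_subdivision_inr]
        have : ∀ i : Bool, (e, i) ∈ F ×ˢ (univ : Finset Bool) ↔ e ∈ F := by simp
        simp only [this, CharTwo.add_self_eq_zero, Sum.elim_inr, Pi.zero_apply])
  have hiff : ∀ e, (e, true) ∈ F ↔ (e, false) ∈ F := by
    intro e
    have h1 := boundary_subdivision_inr a b F e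
    rw [hbF] at h1
    by_cases h2 : (e, true) ∈ F <;> by_cases h3 : (e, false) ∈ F <;> simp [h2, h3] at h1 ⊢
  have hprod : F = (D.filter fun e => (e, true) ∈ F) ×ˢ univ := by
    ext ⟨e, i⟩
    have h1 : (e, i) ∈ F ↔ (e, true) ∈ F := by cases i <;> simp [hiff]
    have h2 : (e, true) ∈ F → e ∈ D := fun h => (mem_product.1 (hF h)).1
    simp only [mem_product, mem_filter, mem_univ, and_true, h1]
    tauto
  refine ⟨D.filter fun e => (e, true) ∈ F, filter_subset _ _, ?_, ?_⟩
  · funext v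
    rw [← boundary_subdivision_inl, ← hprod, hbF]
    rfl
  · rw [hprod, card_product, sum_product, Finset.card_univ, Fintype.card_bool] at hcard
    simp only [Fintype.sum_bool, sum_add_distrib] at hcard
    push_cast at hcard
    linarith

end TJoin

/-- Euler's theorem: an edge set with boundary `s + t` carries a walk from `s` to `t`, no longer
than the number of its edges, through all vertices it joins to `s`. -/
theorem exists_walk_of_boundary [Fintype V] (a b : E → V) (G : SimpleGraph V) (n : ℕ) :
    ∀ (D : Finset E) (s t : V), D.card = n → (∀ e ∈ D, G.Adj (a e) (b e)) →
      boundary a b D = vertexVec s + vertexVec t →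
      ∃ p : G.Walk s t, p.length ≤ D.card ∧ ∀ w, Joins a b D s w → w ∈ p.support := by
  induction n using Nat.strong_induction_on with
  | _ n ih =>
  intro D s t hn hadj hbD
  by_cases hs : ∀ e ∈ D, ¬ Touches a b s e
  · have h0 := boundary_apply_eq_zero a b hs
    rw [hbD] at h0
    obtain rfl := eq_of_vertexVec_add_apply_eq_zero h0
    refine ⟨.nil, by simp, ?_⟩
    rintro w ⟨P, hP, hbP⟩
    have h1 := boundary_apply_eq_zero a b fun e he => hs e (hP he)
    rw [hbP] at h1
    simp [eq_of_vertexVec_add_apply_eq_zero h1]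
  push Not at hs
  obtain ⟨e, he, het⟩ := hs
  set v := otherEnd a b s e with hv
  have hsv : G.Adj s v := by
    have := hadj e he
    rw [hv, otherEnd]
    split_ifs with h
    · rwa [← h]
    · rw [← het.resolve_left h]; exact this.symm
  have hends := ends_eq a b het
  have hbD' : boundary a b (D.erase e) = vertexVec v + vertexVec t := by
    rw [boundary_erase a b he, hbD, hends]
    have := add_self_zmod_two (vertexVec s)
    linear_combination this
  have hcard := card_erase_add_one he
  have hadj' : ∀ f ∈ D.erase e, G.Adj (a f) (b f) := fun f hf => hadj f (mem_of_mem_erase hf)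
  have herase : ∀ P ⊆ D, ∀ w, boundary a b P = vertexVec s + vertexVec w → e ∈ P →
      Joins a b (D.erase e) v w := by
    intro P hP w hbP heP
    refine ⟨P.erase e, erase_subset_erase _ hP, ?_⟩
    rw [boundary_erase a b heP, hbP, hends]
    have := add_self_zmod_two (vertexVec s)
    linear_combination this
  have hnot : ∀ P ⊆ D, e ∉ P → P ⊆ D.erase e := fun P hP heP f hf =>
    mem_erase.2 ⟨fun h => heP (h ▸ hf), hP hf⟩
  by_cases hjoin : Joins a b (D.erase e) v s
  · obtain ⟨p, hp, hsupp⟩ := ih _ (by omega) (D.erase e) v t rfl hadj' hbD'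
    refine ⟨.cons hsv p, by rw [SimpleGraph.Walk.length_cons]; omega, ?_⟩
    rintro w ⟨P, hP, hbP⟩
    rw [SimpleGraph.Walk.support_cons, List.mem_cons]
    right
    apply hsupp
    by_cases heP : e ∈ P
    · exact herase P hP w hbP heP
    · exact hjoin.trans ⟨P, hnot P hP heP, hbP⟩
  -- `e` is a bridge: split at the component of `v`
  set χ := component a b (D.erase e) v with hχ
  have hχe : ∀ f ∈ D.erase e, χ (a f) = χ (b f) := fun f hf => component_ends_eq v hf
  have hχs : χ s = 0 := component_eq_zero_iff.2 hjoin
  have hχv : χ v = 1 := component_eq_one_iff.2 (.refl v)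
  have hχt : χ t = 1 := by
    have h1 := dotProduct_boundary a b χ (D.erase e)
    rw [hbD', dotProduct_add, dotProduct_vertexVec, dotProduct_vertexVec, hχv,
      sum_eq_zero fun f hf => by rw [hχe f hf, CharTwo.add_self_eq_zero]] at h1
    exact (CharTwo.add_eq_zero.1 h1).symm
  have hmul : ∀ w, χ w = 1 → χ * vertexVec w = vertexVec w := by
    intro w hw
    funext u
    by_cases hu : u = w
    · subst hu; simp [hw]
    · simp [vertexVec_of_ne hu]
  have hmul0 : ∀ w, χ w = 0 → χ * vertexVec w = 0 := by
    intro w hw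
    funext u
    by_cases hu : u = w
    · subst hu; simp [hw]
    · simp [vertexVec_of_ne hu]
  set D₁ := (D.erase e).filter fun f => χ (a f) = 1 with hD₁
  set D₂ := (D.erase e).filter fun f => ¬ χ (a f) = 1 with hD₂
  have hb₁ : boundary a b D₁ = vertexVec v + vertexVec t := by
    rw [hD₁, boundary_filter a b hχe, hbD', mul_add, hmul v hχv, hmul t hχt]
  have hb₂ : boundary a b D₂ = vertexVec s + vertexVec s := by
    rw [hD₂, filter_not, boundary_sdiff a b (filter_subset _ _), hbD', ← hD₁, hb₁,
      add_self_zmod_two, add_self_zmod_two]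
  have hsplit := card_filter_add_card_filter_not (s := D.erase e) fun f => χ (a f) = 1
  rw [← hD₁, ← hD₂] at hsplit
  obtain ⟨p₁, hp₁, hs₁⟩ := ih D₁.card (by omega) D₁ v t rfl
    (fun f hf => hadj' f (mem_filter.1 hf).1) hb₁
  obtain ⟨p₂, hp₂, hs₂⟩ := ih D₂.card (by omega) D₂ s s rfl
    (fun f hf => hadj' f (mem_filter.1 hf).1) hb₂
  refine ⟨p₂.append (.cons hsv p₁), ?_, ?_⟩
  · rw [SimpleGraph.Walk.length_append, SimpleGraph.Walk.length_cons]; omega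
  rintro w ⟨P, hP, hbP⟩
  rw [SimpleGraph.Walk.mem_support_append_iff, SimpleGraph.Walk.support_cons, List.mem_cons]
  by_cases heP : e ∈ P
  · right; right
    apply hs₁
    have hjw := herase P hP w hbP heP
    obtain ⟨Q, hQ, hbQ⟩ := hjw
    refine ⟨Q.filter fun f => χ (a f) = 1, filter_subset_filter _ hQ, ?_⟩
    rw [boundary_filter a b fun f hf => hχe f (hQ hf), hbQ, mul_add, hmul v hχv,
      hmul w (component_eq_one_iff.2 ⟨Q, hQ, hbQ⟩)]
  · left
    apply hs₂
    have hPe := hnot P hP heP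
    have hχw : χ w = 0 :=
      component_eq_zero_iff.2 fun h => hjoin (h.trans (Joins.symm ⟨P, hPe, hbP⟩))
    refine ⟨P.filter fun f => ¬ χ (a f) = 1, filter_subset_filter _ hPe, ?_⟩
    rw [filter_not, boundary_sdiff a b (filter_subset _ _),
      boundary_filter a b fun f hf => hχe f (hPe hf), hbP, mul_add, hmul0 s hχs, hmul0 w hχw,
      add_zero, add_zero]

section SimpleGraph

/-- The first end of an unordered pair. -/
noncomputable def fstEnd (e : Sym2 V) : V := (Quot.out e).1

/-- The second end of an unordered pair. -/
noncomputable def sndEnd (e : Sym2 V) : V := (Quot.out e).2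

lemma mk_fstEnd_sndEnd (e : Sym2 V) : s(fstEnd e, sndEnd e) = e := Quot.out_eq e

lemma vertexVec_ends_mk (u v : V) :
    vertexVec (fstEnd s(u, v)) + vertexVec (sndEnd s(u, v)) = vertexVec u + vertexVec v := by
  rcases Sym2.eq_iff.1 (mk_fstEnd_sndEnd s(u, v)) with ⟨h1, h2⟩ | ⟨h1, h2⟩
  · rw [h1, h2]
  · rw [h1, h2, add_comm]

lemma joins_edgeFinset_of_connected [Fintype V] {G : SimpleGraph V} (hG : G.Connected) (s w : V) :
    Joins fstEnd sndEnd G.edgeFinset s w := by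
  obtain ⟨p⟩ := hG.preconnected s w
  induction p with
  | nil => exact .refl _
  | @cons u v _ h _ ih =>
    refine Joins.trans ⟨{s(u, v)}, ?_, ?_⟩ ih
    · exact singleton_subset_iff.2 (SimpleGraph.mem_edgeFinset.2 h)
    · rw [boundary_singleton, vertexVec_ends_mk]

end SimpleGraph

end EdgeSpace

namespace HeldKarp

open Finset EdgeSpace

variable {V : Type*} {G : SimpleGraph V} {x : Sym2 V → ℝ} {s t : V}

/-- The edge `e` has exactly one end in `S`. -/
def Crosses (S : Set V) (e : Sym2 V) : Prop := ∃ a b, e = s(a, b) ∧ a ∈ S ∧ b ∉ S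

lemma crosses_mk {S : Set V} {u v : V} : Crosses S s(u, v) ↔ ¬(u ∈ S ↔ v ∈ S) := by
  constructor
  · rintro ⟨a, b, h, ha, hb⟩
    rcases Sym2.eq_iff.1 h with ⟨rfl, rfl⟩ | ⟨rfl, rfl⟩ <;> tauto
  · intro h
    by_cases hu : u ∈ S
    · exact ⟨u, v, rfl, hu, by tauto⟩
    · exact ⟨v, u, Sym2.eq_swap, by tauto, hu⟩

variable [Fintype V]

lemma cutValue_eq_sum (S : Set V) :
    cutValue G x S = ∑ e ∈ G.edgeFinset, if Crosses S e then x e else 0 := by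
  rw [cutValue, ← sum_filter]
  refine sum_congr ?_ fun _ _ => rfl
  ext e
  rw [mem_filter, mem_filter, SimpleGraph.mem_edgeFinset]
  simp [Crosses]

lemma lpValue_eq_sum : lpValue G x = ∑ e ∈ G.edgeFinset, x e := by
  rw [lpValue]
  refine sum_congr ?_ fun _ _ => rfl
  ext e
  simp

/-- An inequality between sums of two cuts, checked edge by edge. -/
lemma cutValue_add_le (hx : ∀ e ∈ G.edgeSet, 0 ≤ x e) {A B P Q : Set V}
    (h : ∀ u v, G.Adj u v → (Crosses A s(u, v) → Crosses P s(u, v) ∨ Crosses Q s(u, v)) ∧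
      (Crosses B s(u, v) → Crosses P s(u, v) ∨ Crosses Q s(u, v)) ∧
      (Crosses A s(u, v) → Crosses B s(u, v) → Crosses P s(u, v) ∧ Crosses Q s(u, v))) :
    cutValue G x A + cutValue G x B ≤ cutValue G x P + cutValue G x Q := by
  simp only [cutValue_eq_sum, ← sum_add_distrib]
  refine sum_le_sum fun e he => ?_
  rw [SimpleGraph.mem_edgeFinset] at he
  have h0 := hx e he
  induction e with
  | _ u v =>
  have := h u v he
  by_cases h1 : Crosses A s(u, v) <;> by_cases h2 : Crosses B s(u, v) <;>
    by_cases h3 : Crosses P s(u, v) <;> by_cases h4 : Crosses Q s(u, v) <;>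
    simp only [h1, h2, h3, h4, if_true, if_false] at this ⊢ <;> first | linarith | tauto

/-- The narrow cuts of a Held-Karp path solution. -/
def Narrow (G : SimpleGraph V) (x : Sym2 V → ℝ) (s t : V) (S : Set V) : Prop :=
  s ∈ S ∧ t ∉ S ∧ cutValue G x S < 2

/-- The narrow cuts together with the two trivial ones. -/
def Level (G : SimpleGraph V) (x : Sym2 V → ℝ) (s t : V) (S : Set V) : Prop :=
  S = ∅ ∨ S = Set.univ ∨ Narrow G x s t S

lemma Level.subset_or_subset (hx : IsHeldKarpPath G s t x) {S R : Set V}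
    (hS : Level G x s t S) (hR : Level G x s t R) : S ⊆ R ∨ R ⊆ S := by
  rcases hS with rfl | rfl | hS
  · exact .inl (Set.empty_subset _)
  · exact .inr (Set.subset_univ _)
  rcases hR with rfl | rfl | hR
  · exact .inr (Set.empty_subset _)
  · exact .inl (Set.subset_univ _)
  by_contra! hcon
  obtain ⟨u, huS, huR⟩ := Set.not_subset.1 hcon.1
  obtain ⟨v, hvR, hvS⟩ := Set.not_subset.1 hcon.2
  have h1 := hx.2.1 (S \ R) ⟨u, huS, huR⟩ (fun h => (h ▸ Set.mem_univ v : v ∈ S \ R).2 hvR)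
    (by simp [hS.1, hS.2.1, hR.1])
  have h2 := hx.2.1 (R \ S) ⟨v, hvR, hvS⟩ (fun h => (h ▸ Set.mem_univ u : u ∈ R \ S).2 huS)
    (by simp [hR.1, hR.2.1, hS.1])
  have h3 : cutValue G x (S \ R) + cutValue G x (R \ S) ≤ cutValue G x S + cutValue G x R := by
    refine cutValue_add_le hx.1 fun a b _ => ?_
    simp only [crosses_mk, Set.mem_sdiff]
    tauto
  have := hS.2.2
  have := hR.2.2
  linarith

lemma cutValue_empty : cutValue G x ∅ = 0 := by
  rw [cutValue_eq_sum]
  exact sum_eq_zero fun e _ => if_neg fun ⟨_, _, _, h, _⟩ => h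

lemma cutValue_univ : cutValue G x Set.univ = 0 := by
  rw [cutValue_eq_sum]
  exact sum_eq_zero fun e _ => if_neg fun ⟨_, _, _, _, h⟩ => h trivial

lemma one_le_cutValue (hx : IsHeldKarpPath G s t x) {S : Set V} (h₁ : S.Nonempty)
    (h₂ : S ≠ Set.univ) : 1 ≤ cutValue G x S := by
  by_cases h : s ∈ S ↔ t ∈ S
  · linarith [hx.2.1 S h₁ h₂ h]
  · exact hx.2.2 S h

/-- The region between two levels induces a connected subgraph. -/
lemma exists_adj_of_levels (hx : IsHeldKarpPath G s t x) {P Q A B : Set V}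
    (hP : Level G x s t P) (hQ : Level G x s t Q) (hPQ : P ⊆ Q)
    (hAB : ∀ v, v ∈ A ∨ v ∈ B ↔ v ∈ Q ∧ v ∉ P) (hdisj : ∀ v, v ∈ A → v ∉ B)
    (hA : A.Nonempty) (hB : B.Nonempty) : ∃ u ∈ A, ∃ v ∈ B, G.Adj u v := by
  by_contra! hcon
  obtain ⟨u, hu⟩ := hA
  obtain ⟨v, hv⟩ := hB
  have hsum : cutValue G x A + cutValue G x B ≤ cutValue G x P + cutValue G x Q := by
    refine cutValue_add_le hx.1 fun a b hab => ?_
    have h3 : a ∈ A → b ∉ B := fun ha hb => hcon a ha b hb hab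
    have h4 : b ∈ A → a ∉ B := fun ha hb => hcon b ha a hb hab.symm
    have h5 := hAB a
    have h6 := hAB b
    have h7 := @hPQ a
    have h8 := @hPQ b
    have h9 := hdisj a
    have h10 := hdisj b
    simp only [crosses_mk]
    clear hcon hAB hdisj hPQ hP hQ hx hab
    grind
  have hAu : A ≠ Set.univ := fun h => hdisj v (h ▸ Set.mem_univ v) hv
  have hBu : B ≠ Set.univ := fun h => hdisj u hu (h ▸ Set.mem_univ u)
  have hA1 := one_le_cutValue hx ⟨u, hu⟩ hAu
  have hB1 := one_le_cutValue hx ⟨v, hv⟩ hBu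
  have hA2 := hx.2.1 A ⟨u, hu⟩ hAu
  have hB2 := hx.2.1 B ⟨v, hv⟩ hBu
  have hu' := (hAB u).1 (.inl hu)
  have hA : ∀ w ∈ A, w ∈ Q ∧ w ∉ P := fun w hw => (hAB w).1 (.inl hw)
  have hB : ∀ w ∈ B, w ∈ Q ∧ w ∉ P := fun w hw => (hAB w).1 (.inr hw)
  rcases hP with rfl | rfl | hP
  · rw [cutValue_empty] at hsum
    rcases hQ with rfl | rfl | hQ
    · exact hu'.1
    · rw [cutValue_univ] at hsum
      linarith
    · have hQ2 := hQ.2.2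
      have htA : t ∉ A := fun h => hQ.2.1 (hA t h).1
      have htB : t ∉ B := fun h => hQ.2.1 (hB t h).1
      by_cases h : s ∈ A
      · linarith [hB2 (iff_of_false (hdisj s h) htB)]
      · linarith [hA2 (iff_of_false h htA)]
  · exact hu'.2 trivial
  · have hP2 := hP.2.2
    have hsA : s ∉ A := fun h => (hA s h).2 hP.1
    have hsB : s ∉ B := fun h => (hB s h).2 hP.1
    rcases hQ with rfl | rfl | hQ
    · exact hu'.1
    · rw [cutValue_univ] at hsum
      by_cases h : t ∈ A
      · linarith [hB2 (iff_of_false hsB (hdisj t h))]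
      · linarith [hA2 (iff_of_false hsA h)]
    · have hQ2 := hQ.2.2
      have htA : t ∉ A := fun h => hQ.2.1 (hA t h).1
      have htB : t ∉ B := fun h => hQ.2.1 (hB t h).1
      linarith [hA2 (iff_of_false hsA htA), hB2 (iff_of_false hsB htB)]

lemma exists_level_pred (hx : IsHeldKarpPath G s t x) {Q : Set V} (hQ : Level G x s t Q)
    (hne : Q ≠ ∅) : ∃ P, Level G x s t P ∧ P ⊂ Q ∧
      ∀ R, Level G x s t R → R ⊆ P ∨ Q ⊆ R := by
  obtain ⟨P, hP⟩ := (Set.toFinite {P | Level G x s t P ∧ P ⊂ Q}).exists_maximal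
    ⟨∅, .inl rfl, Set.empty_ssubset.2 (Set.nonempty_iff_ne_empty.2 hne)⟩
  refine ⟨P, hP.1.1, hP.1.2, fun R hR => ?_⟩
  rcases hQ.subset_or_subset hx hR with h | h
  · exact .inr h
  by_cases hQR : Q ⊆ R
  · exact .inr hQR
  left
  rcases hR.subset_or_subset hx hP.1.1 with h' | h'
  · exact h'
  · exact hP.2 ⟨hR, h, hQR⟩ h'

lemma exists_level_succ (hx : IsHeldKarpPath G s t x) {P : Set V} (hP : Level G x s t P)
    (hne : P ≠ Set.univ) : ∃ Q, Level G x s t Q ∧ P ⊂ Q ∧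
      ∀ R, Level G x s t R → R ⊆ P ∨ Q ⊆ R := by
  obtain ⟨Q, hQ⟩ := (Set.toFinite {Q | Level G x s t Q ∧ P ⊂ Q}).exists_minimal
    ⟨Set.univ, .inr (.inl rfl), Set.ssubset_univ_iff.2 hne⟩
  refine ⟨Q, hQ.1.1, hQ.1.2, fun R hR => ?_⟩
  rcases hR.subset_or_subset hx hP with h | h
  · exact .inl h
  by_cases hRP : R ⊆ P
  · exact .inl hRP
  right
  rcases hR.subset_or_subset hx hQ.1.1 with hRQ | hRQ
  · exact hQ.2 ⟨hR, h, hRP⟩ hRQ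
  · exact hRQ

/-- Every narrow cut contains an edge crossing no other narrow cut. -/
lemma exists_adj_crossing_only (hx : IsHeldKarpPath G s t x) {S : Set V}
    (hS : Narrow G x s t S) :
    ∃ u ∈ S, ∃ v ∉ S, G.Adj u v ∧ ∀ R, Level G x s t R → R ≠ S → (u ∈ R ↔ v ∈ R) := by
  have hSl : Level G x s t S := .inr (.inr hS)
  obtain ⟨P, hP, hPS, hpred⟩ := exists_level_pred hx hSl
    (Set.nonempty_iff_ne_empty.1 ⟨s, hS.1⟩)
  obtain ⟨Q, hQ, hSQ, hsucc⟩ := exists_level_succ hx hSl fun h => hS.2.1 (h ▸ Set.mem_univ t)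
  obtain ⟨u, hu, v, hv, huv⟩ := exists_adj_of_levels hx hP hQ (hPS.1.trans hSQ.1)
    (A := S \ P) (B := Q \ S)
    (fun v => by
      have h1 := @hPS.1 v
      have h2 := @hSQ.1 v
      simp only [Set.mem_sdiff]
      tauto)
    (fun v h h' => h'.2 h.1) (Set.nonempty_of_ssubset hPS) (Set.nonempty_of_ssubset hSQ)
  refine ⟨u, hu.1, v, hv.2, huv, fun R hR hRS => ?_⟩
  rcases hpred R hR with h | h
  · exact iff_of_false (fun h' => hu.2 (h h')) fun h' => hv.2 (hPS.1 (h h'))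
  · rcases hsucc R hR with hRS' | hQR
    · exact absurd (hRS'.antisymm h) hRS
    · exact iff_of_true (h hu.1) (hQR hv.1)

/-- Some spanning tree meets every narrow cut in exactly one edge. -/
theorem exists_isTree_card_crosses_eq_one (hx : IsHeldKarpPath G s t x) :
    ∃ J ≤ G, J.IsTree ∧
      ∀ S, Narrow G x s t S → (J.edgeFinset.filter (Crosses S)).card = 1 := by
  have hch : ∀ S : Set V, ∃ u v, Narrow G x s t S → u ∈ S ∧ v ∉ S ∧ G.Adj u v ∧
      ∀ R, Level G x s t R → R ≠ S → (u ∈ R ↔ v ∈ R) := by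
    intro S
    by_cases hS : Narrow G x s t S
    · obtain ⟨u, hu, v, hv, h⟩ := exists_adj_crossing_only hx hS
      exact ⟨u, v, fun _ => ⟨hu, hv, h⟩⟩
    · exact ⟨s, s, fun h => absurd h hS⟩
  choose p q hpq using hch
  let H : SimpleGraph V :=
    { Adj := fun u v => G.Adj u v ∧ ((∀ R, Level G x s t R → (u ∈ R ↔ v ∈ R)) ∨
        ∃ S, Narrow G x s t S ∧ s(u, v) = s(p S, q S))
      symm := ⟨fun u v h => ⟨h.1.symm, h.2.imp (fun h R hR => (h R hR).symm)
        fun ⟨S, hS, h⟩ => ⟨S, hS, Sym2.eq_swap.trans h⟩⟩⟩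
      loopless := ⟨fun u h => h.1.ne rfl⟩ }
  have hHG : H ≤ G := fun u v h => h.1
  have hcross : ∀ S, Narrow G x s t S → ∀ u v, H.Adj u v → Crosses S s(u, v) →
      s(u, v) = s(p S, q S) := by
    rintro S hS u v ⟨-, h | ⟨R, hR, h⟩⟩ huv
    · exact absurd (h S (.inr (.inr hS))) (crosses_mk.1 huv)
    · by_cases hRS : S = R
      · rw [hRS, h]
      · rw [h, crosses_mk] at huv
        exact absurd ((hpq R hR).2.2.2 S (.inr (.inr hS)) hRS) huv
  have hclosed : ∀ C : Set V, (∀ u v, H.Adj u v → (u ∈ C ↔ v ∈ C)) → ∀ n, ∀ Q : Set V,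
      Q.ncard = n → Level G x s t Q → ∀ u ∈ Q, ∀ v ∈ Q, (u ∈ C ↔ v ∈ C) := by
    intro C hC n
    induction n using Nat.strong_induction_on with
    | _ n ih =>
    intro Q hn hQ u hu v hv
    obtain ⟨P, hP, hPQ, hpred⟩ := exists_level_pred hx hQ (Set.nonempty_iff_ne_empty.1 ⟨u, hu⟩)
    have hlayer : ∀ u v, u ∈ Q → u ∉ P → v ∈ Q → v ∉ P → u ∈ C → v ∈ C := by
      intro u v hu hu' hv hv' huC
      by_contra hvC
      obtain ⟨a, ha, b, hb, hab⟩ := exists_adj_of_levels hx hP hQ hPQ.1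
        (A := (Q \ P) ∩ C) (B := (Q \ P) \ C)
        (fun w => by simp only [Set.mem_inter_iff, Set.mem_sdiff]; tauto)
        (fun w h h' => h'.2 h.2) ⟨u, ⟨hu, hu'⟩, huC⟩ ⟨v, ⟨hv, hv'⟩, hvC⟩
      refine hb.2 ((hC a b ⟨hab, .inl fun R hR => ?_⟩).1 ha.2)
      rcases hpred R hR with h | h
      · exact iff_of_false (fun h' => ha.1.2 (h h')) fun h' => hb.1.2 (h h')
      · exact iff_of_true (h ha.1.1) (h hb.1.1)
    have hlayer' : ∀ u v, u ∈ Q → u ∉ P → v ∈ Q → v ∉ P → (u ∈ C ↔ v ∈ C) :=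
      fun u v h1 h2 h3 h4 => ⟨hlayer u v h1 h2 h3 h4, hlayer v u h3 h4 h1 h2⟩
    rcases hP with rfl | rfl | hP'
    · exact hlayer' u v hu id hv id
    · exact absurd (Set.subset_univ Q) hPQ.2
    · obtain ⟨hpP, hqP, hadj, honly⟩ := hpq P hP'
      have hqQ : q P ∈ Q := (honly Q hQ hPQ.ne').1 (hPQ.1 hpP)
      have hCpq : p P ∈ C ↔ q P ∈ C := hC _ _ ⟨hadj, .inr ⟨P, hP', rfl⟩⟩
      have hall : ∀ w ∈ Q, (w ∈ C ↔ q P ∈ C) := by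
        intro w hw
        by_cases hwP : w ∈ P
        · rw [← hCpq]
          exact ih _ (hn ▸ Set.ncard_lt_ncard hPQ) P rfl (.inr (.inr hP')) w hwP _ hpP
        · exact hlayer' w _ hw hwP hqQ hqP
      rw [hall u hu, hall v hv]
  have hHconn : H.Connected := by
    have : Nonempty V := ⟨s⟩
    refine ⟨fun u v => ?_⟩
    refine (hclosed {w | H.Reachable u w} (fun a b hab => ?_) _ Set.univ rfl (.inr (.inl rfl)) u
      trivial v trivial).1 (SimpleGraph.Reachable.refl u)
    exact ⟨fun h => h.trans hab.reachable, fun h => h.trans hab.symm.reachable⟩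
  obtain ⟨J, hJH, hJ⟩ := hHconn.exists_isTree_le
  refine ⟨J, hJH.trans hHG, hJ, fun S hS => ?_⟩
  have hsub : J.edgeFinset.filter (Crosses S) ⊆ {s(p S, q S)} := by
    intro e he
    rw [mem_filter, SimpleGraph.mem_edgeFinset] at he
    rw [mem_singleton]
    induction e with
    | _ u v => exact hcross S hS u v (hJH he.1) he.2
  refine le_antisymm ((card_le_card hsub).trans_eq (card_singleton _)) ?_
  rw [Nat.one_le_iff_ne_zero, card_ne_zero]
  by_contra hemp
  rw [not_nonempty_iff_eq_empty, filter_eq_empty_iff] at hemp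
  refine hS.2.1 ?_
  obtain ⟨w⟩ := hJ.connected.preconnected s t
  have : ∀ u v, J.Walk u v → u ∈ S → v ∈ S := by
    intro u v w
    induction w with
    | nil => exact id
    | cons h _ ih =>
      intro hu
      have := hemp (SimpleGraph.mem_edgeFinset.2 (J.mem_edgeSet.2 h))
      rw [crosses_mk, not_not] at this
      exact ih (this.1 hu)
  exact this s t w hS.1

/-- The handshake bound: a Held-Karp path solution has value at least `|V| - 1`. -/
lemma card_le_lpValue_add_one (hx : IsHeldKarpPath G s t x) (hV : 2 ≤ Fintype.card V) :
    (Fintype.card V : ℝ) ≤ lpValue G x + 1 := by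
  have hnt : Nontrivial V := Fintype.one_lt_card_iff_nontrivial.1 hV
  have hv : ∀ v : V, (2 : ℝ) - (if v = s then 1 else 0) - (if v = t then 1 else 0)
      ≤ cutValue G x {v} := by
    intro v
    obtain ⟨w, hw⟩ := exists_ne v
    have hne : ({v} : Set V) ≠ Set.univ := fun h => hw (h ▸ Set.mem_univ w : w ∈ ({v} : Set V))
    have h1 := one_le_cutValue hx (Set.singleton_nonempty v) hne
    have h2 := hx.2.1 {v} (Set.singleton_nonempty v) hne
    simp only [Set.mem_singleton_iff] at h2
    split_ifs with hs ht ht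
    · linarith
    · linarith
    · linarith
    · linarith [h2 ⟨fun h => absurd h.symm hs, fun h => absurd h.symm ht⟩]
  have hsum := sum_le_sum fun v (_ : v ∈ univ) => hv v
  have hdouble : ∑ v : V, cutValue G x {v} = 2 * lpValue G x := by
    simp only [cutValue_eq_sum, lpValue_eq_sum]
    rw [sum_comm, mul_sum]
    refine sum_congr rfl fun e he => ?_
    rw [SimpleGraph.mem_edgeFinset] at he
    induction e with
    | _ a b =>
    have hab : a ≠ b := G.ne_of_adj he
    have h1 : ∀ v, (if Crosses {v} s(a, b) then x s(a, b) else 0)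
        = (if a = v then x s(a, b) else 0) + if b = v then x s(a, b) else 0 := by
      intro v
      simp only [crosses_mk, Set.mem_singleton_iff]
      by_cases h : a = v <;> by_cases h' : b = v <;> simp [h, h']
      exact absurd (h.trans h'.symm) hab
    simp only [h1, sum_add_distrib, sum_ite_eq, mem_univ, if_true]
    ring
  rw [hdouble, sum_sub_distrib, sum_sub_distrib, sum_const, Finset.card_univ, nsmul_eq_mul,
    sum_ite_eq' univ s, sum_ite_eq' univ t] at hsum
  simp only [mem_univ, if_true] at hsum
  linarith

/-- Every Held-Karp path solution is within a factor `3 / 2` of a spanning walk. -/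
theorem exists_spanning_walk (hx : IsHeldKarpPath G s t x) (hV : 2 ≤ Fintype.card V) :
    ∃ w : G.Walk s t, (∀ u, u ∈ w.support) ∧ (w.length : ℝ) ≤ 3 / 2 * lpValue G x := by
  obtain ⟨J, hJG, hJ, hcross⟩ := exists_isTree_card_crosses_eq_one hx
  have hJsub : J.edgeFinset ⊆ G.edgeFinset := SimpleGraph.edgeFinset_mono hJG
  set T : V → ZMod 2 := boundary fstEnd sndEnd J.edgeFinset + (vertexVec s + vertexVec t) with hT
  have hcutset : ∀ (χ : V → ZMod 2) (e : Sym2 V),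
      Crosses {v | χ v = 1} e ↔ χ (fstEnd e) ≠ χ (sndEnd e) := by
    intro χ e
    rw [← mk_fstEnd_sndEnd e, crosses_mk, mk_fstEnd_sndEnd]
    have : ∀ y z : ZMod 2, ¬(y = 1 ↔ z = 1) ↔ y ≠ z := by decide
    exact this _ _
  have hTχ : ∀ χ : V → ZMod 2, χ ⬝ᵥ T
      = ((J.edgeFinset.filter (Crosses {v | χ v = 1})).card : ZMod 2) + (χ s + χ t) := by
    intro χ
    rw [hT, dotProduct_add, dotProduct_add, dotProduct_vertexVec, dotProduct_vertexVec,
      dotProduct_boundary_eq_card]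
    simp only [hcutset]
  obtain ⟨F, hF, hbF, hFcard⟩ := exists_boundary_eq_card_le (V := V) fstEnd sndEnd G.edgeFinset T
    (fun e => x e / 2)
    (fun e he => div_nonneg (hx.1 e (SimpleGraph.mem_edgeFinset.1 he)) (by norm_num))
    (fun χ hχ => by
      have h1 : ∑ e ∈ G.edgeFinset, (if χ (fstEnd e) ≠ χ (sndEnd e) then x e / 2 else 0)
          = cutValue G x {v | χ v = 1} / 2 := by
        rw [cutValue_eq_sum, sum_div]
        refine sum_congr rfl fun e _ => ?_
        simp only [hcutset]
        split_ifs <;> simp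
      rw [h1]
      suffices 2 ≤ cutValue G x {v | χ v = 1} by linarith
      rw [hTχ] at hχ
      by_cases hst : χ s = χ t
      · refine hx.2.1 _ ?_ ?_ (by simp [hst])
        · by_contra hemp
          rw [Set.not_nonempty_iff_eq_empty] at hemp
          rw [hemp, filter_false_of_mem (fun e _ ⟨_, _, _, h, _⟩ => h), hst,
            CharTwo.add_self_eq_zero] at hχ
          simp at hχ
        · intro huniv
          rw [huniv, filter_false_of_mem (fun e _ ⟨_, _, _, _, h⟩ => h trivial), hst,
            CharTwo.add_self_eq_zero] at hχ
          simp at hχ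
      · have hst1 : χ s + χ t = 1 := by
          revert hst
          generalize χ s = y
          generalize χ t = z
          revert y z
          decide
        by_contra! hlt
        rcases zmod_two_cases (χ s) with hs | hs
        · have ht : χ t = 1 := by rw [hs, zero_add] at hst1; exact hst1
          have hcompl : ∀ e : Sym2 V, Crosses {v | χ v = 1}ᶜ e ↔ Crosses {v | χ v = 1} e := by
            intro e
            induction e with
            | _ a b => simp only [crosses_mk, Set.mem_compl_iff]; tauto
          have hnarrow : Narrow G x s t {v | χ v = 1}ᶜ := by
            refine ⟨by simp [hs], by simp [ht], ?_⟩
            rw [cutValue_eq_sum] at hlt ⊢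
            simpa only [hcompl] using hlt
          have h2 := hcross _ hnarrow
          simp only [hcompl] at h2
          rw [h2, hst1] at hχ
          revert hχ; decide
        · have ht : χ t ≠ 1 := fun h => hst (hs.trans h.symm)
          rw [hcross _ ⟨hs, ht, hlt⟩, hst1] at hχ
          revert hχ; decide)
    (by
      have hGconn : G.Connected := hJ.connected.mono hJG
      obtain ⟨P, hP, hbP⟩ := joins_edgeFinset_of_connected hGconn s t
      obtain ⟨R, hR, hbR⟩ := exists_subset_boundary_eq_add fstEnd sndEnd hJsub hP
      exact ⟨R, hR, by rw [hbR, hbP]⟩)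
  set a : Sym2 V ⊕ Sym2 V → V := Sum.elim fstEnd fstEnd with ha
  set b : Sym2 V ⊕ Sym2 V → V := Sum.elim sndEnd sndEnd with hb
  have hbdsum : ∀ K L : Finset (Sym2 V), boundary a b (K.disjSum L)
      = boundary fstEnd sndEnd K + boundary fstEnd sndEnd L := by
    intro K L
    rw [boundary, sum_disjSum]
    rfl
  have hadj : ∀ e ∈ G.edgeFinset, G.Adj (fstEnd e) (sndEnd e) := by
    intro e he
    rwa [← mk_fstEnd_sndEnd e, SimpleGraph.mem_edgeFinset, SimpleGraph.mem_edgeSet] at he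
  obtain ⟨w, hw, hsupp⟩ := exists_walk_of_boundary a b G _ (J.edgeFinset.disjSum F) s t rfl
    (fun e he => by
      rcases mem_disjSum.1 he with ⟨f, hf, rfl⟩ | ⟨f, hf, rfl⟩
      exacts [hadj f (hJsub hf), hadj f (hF hf)])
    (by rw [hbdsum, hbF, hT, ← add_assoc, add_self_zmod_two, zero_add])
  refine ⟨w, fun u => hsupp u ?_, ?_⟩
  · obtain ⟨P, hP, hbP⟩ := joins_edgeFinset_of_connected hJ.connected s u
    refine ⟨P.disjSum ∅, disjSum_mono hP (empty_subset _), ?_⟩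
    rw [hbdsum, boundary_empty, add_zero, hbP]
  · have h1 := card_le_lpValue_add_one hx hV
    have h2 := hJ.card_edgeFinset
    rw [card_disjSum] at hw
    rw [← sum_div, ← lpValue_eq_sum] at hFcard
    have h3 : ((J.edgeFinset.card : ℝ)) + 1 = Fintype.card V := by exact_mod_cast h2
    have h4 : (w.length : ℝ) ≤ J.edgeFinset.card + F.card := by exact_mod_cast hw
    linarith

lemma exists_isHeldKarpPath (hG : G.Connected) (s t : V) : ∃ x, IsHeldKarpPath G s t x := by
  have hcut : ∀ S : Set V, S.Nonempty → S ≠ Set.univ → 2 ≤ cutValue G (fun _ => 2) S := by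
    rintro S ⟨u, hu⟩ hne
    obtain ⟨v, hv⟩ := (Set.ne_univ_iff_exists_notMem S).1 hne
    obtain ⟨w⟩ := hG.preconnected u v
    obtain ⟨d, hd, hd1, hd2⟩ := w.exists_boundary_dart S hu hv
    rw [cutValue_eq_sum]
    refine le_trans (le_of_eq ?_) (single_le_sum (f := fun e => if Crosses S e then (2 : ℝ) else 0)
      (fun e _ => by split_ifs <;> norm_num) (SimpleGraph.mem_edgeFinset.2 (G.mem_edgeSet.2 d.adj)))
    rw [if_pos ⟨_, _, rfl, hd1, hd2⟩]
  refine ⟨fun _ => 2, fun _ _ => by norm_num, fun S h1 h2 _ => hcut S h1 h2, fun S h => ?_⟩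
  refine le_trans (by norm_num) (hcut S ?_ ?_)
  · by_contra hemp
    simp [Set.not_nonempty_iff_eq_empty.1 hemp] at h
  · rintro rfl
    simp at h

end HeldKarp

theorem graphic_tspp_nineteen_twelfths (ε : ℝ) (hε : 0 < ε) :
    ∃ n₀ : ℕ, ∀ (V : Type) [Fintype V] (G : SimpleGraph V),
      G.Connected → n₀ ≤ Fintype.card V → ∀ s t : V,
      ∃ w : G.Walk s t, (∀ u : V, u ∈ w.support) ∧
        (w.length : ℝ) ≤ (19 / 12 + ε) * optLPPath G s t := by
  refine ⟨2, fun V _ G hG hV s t => ?_⟩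
  obtain ⟨x₀, hx₀⟩ := HeldKarp.exists_isHeldKarpPath hG s t
  have hspan : ∃ n, ∃ w : G.Walk s t, (∀ u, u ∈ w.support) ∧ w.length = n := by
    obtain ⟨w, hw, -⟩ := HeldKarp.exists_spanning_walk hx₀ hV
    exact ⟨_, w, hw, rfl⟩
  obtain ⟨w, hw, hwlen⟩ := Nat.find_spec hspan
  refine ⟨w, hw, ?_⟩
  have hopt : 2 / 3 * (w.length : ℝ) ≤ optLPPath G s t := by
    refine le_csInf ⟨_, x₀, hx₀, rfl⟩ ?_
    rintro _ ⟨x, hx, rfl⟩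
    obtain ⟨w', hw', hle⟩ := HeldKarp.exists_spanning_walk hx hV
    have hmin : w.length ≤ w'.length := hwlen ▸ Nat.find_min' hspan ⟨w', hw', rfl⟩
    have : (w.length : ℝ) ≤ w'.length := by exact_mod_cast hmin
    linarith
  have hlen : (0 : ℝ) ≤ w.length := Nat.cast_nonneg _
  nlinarith
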